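/- For d ≥ 1, let α be a cone angle on ℝ^d. Then the affine hull of the set of exterior angle vectors { α̌(P) : P ⊂ ℝ^d a d-dimensional polytope } equals { (a_0, …, a_{d−1}) ∈ ℝ^d : a_0 = 1 }. -/

import Mathlib

open scoped BigOperators InnerProductSpace Pointwise

noncomputable section

/-- Euclidean space `ℝ^d`. -/
abbrev Euc (d : ℕ) : Type := EuclideanSpace ℝ (Fin d)

namespace GramAngles

variable {d : ℕ}

/-- The conical (positive) hull of a set. -/
def posHull (S : Set (Euc d)) : Set (Euc d) :=
  {u | ∃ c : ℝ, ∃ p ∈ S, 0 ≤ c ∧ u = c • p}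

/-- The dimension of a set: the rank of the linear subspace parallel to its affine hull. -/
def sdim (S : Set (Euc d)) : ℕ := Module.finrank ℝ (vectorSpan ℝ S)

/-- A polyhedral cone with apex at the origin: a finitely generated convex cone. -/
def IsPolyhedralCone (C : Set (Euc d)) : Prop :=
  ∃ (n : ℕ) (v : Fin n → Euc d),
    C = {x | ∃ c : Fin n → ℝ, (∀ i, 0 ≤ c i) ∧ x = ∑ i, c i • v i}

/-- A cone angle on `ℝ^d`: a simple, normalized valuation on polyhedral cones. -/
structure ConeAngle (d : ℕ) where
  toFun : Set (Euc d) → ℝ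
  zero' : toFun {0} = 0
  union' : ∀ C C' : Set (Euc d), IsPolyhedralCone C → IsPolyhedralCone C' →
    IsPolyhedralCone (C ∪ C') → IsPolyhedralCone (C ∩ C') →
    toFun (C ∪ C') = toFun C + toFun C' - toFun (C ∩ C')
  simple' : ∀ C : Set (Euc d), IsPolyhedralCone C → sdim C < d → toFun C = 0
  norm' : toFun Set.univ = 1

/-- A (convex) polytope: the convex hull of a nonempty finite point set. -/
def IsPolytope (P : Set (Euc d)) : Prop :=
  ∃ s : Finset (Euc d), s.Nonempty ∧ P = convexHull ℝ (s : Set (Euc d))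

/-- Faces of a polytope are its exposed subsets (including `∅` and `P` itself). -/
def IsFace (P F : Set (Euc d)) : Prop := IsExposed ℝ P F

open Classical in
/-- A chosen point in the relative interior of `F`. -/
def relPt (F : Set (Euc d)) : Euc d :=
  if h : (intrinsicInterior ℝ F).Nonempty then h.some else 0

/-- The tangent (inner) cone `T_F G = cone(-q + G) + L(G)^⊥`, `q ∈ relint F`. -/
def innerCone (F G : Set (Euc d)) : Set (Euc d) :=
  posHull ((fun x => x - relPt F) '' G) + (((vectorSpan ℝ G)ᗮ : Submodule ℝ (Euc d)) : Set (Euc d))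

/-- The normal cone `N_F G` of `G` at a face `F`. -/
def normalCone (F G : Set (Euc d)) : Set (Euc d) :=
  {c | ∀ x ∈ F, ∀ y ∈ G, ⟪c, y⟫_ℝ ≤ ⟪c, x⟫_ℝ}

/-- The outer cone `O_F G = N_F G + L(F)`. -/
def outerCone (F G : Set (Euc d)) : Set (Euc d) :=
  normalCone F G + ((vectorSpan ℝ F : Submodule ℝ (Euc d)) : Set (Euc d))

/-- Interior angle of `G` at its face `F`, measured by the cone angle `α`. -/
def intAngle (α : ConeAngle d) (F G : Set (Euc d)) : ℝ := α.toFun (innerCone F G)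

/-- Exterior angle of `G` at its face `F`, measured by the cone angle `α`. -/
def extAngle (α : ConeAngle d) (F G : Set (Euc d)) : ℝ := α.toFun (outerCone F G)

/-- `α̂_i(P)`: sum of interior angles over all `i`-dimensional (nonempty) faces of `P`. -/
def intAngleSum (α : ConeAngle d) (P : Set (Euc d)) (i : ℕ) : ℝ :=
  ∑ᶠ F ∈ {F : Set (Euc d) | IsFace P F ∧ F.Nonempty ∧ sdim F = i}, intAngle α F P

/-- `α̌_i(P)`: sum of exterior angles over all `i`-dimensional (nonempty) faces of `P`. -/
def extAngleSum (α : ConeAngle d) (P : Set (Euc d)) (i : ℕ) : ℝ :=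
  ∑ᶠ F ∈ {F : Set (Euc d) | IsFace P F ∧ F.Nonempty ∧ sdim F = i}, extAngle α F P

/-- A zonotope: a translate of a Minkowski sum of finitely many segments. -/
def IsZonotope (Z : Set (Euc d)) : Prop :=
  ∃ (t : Euc d) (n : ℕ) (z : Fin n → Euc d),
    Z = {x | ∃ l : Fin n → ℝ, (∀ i, |l i| ≤ 1) ∧ x = t + ∑ i, l i • z i}

/-- The face of `P` on which the linear functional `⟪c, ·⟫` is maximized. -/
def maxFace (P : Set (Euc d)) (c : Euc d) : Set (Euc d) :=
  {x ∈ P | ∀ y ∈ P, ⟪c, y⟫_ℝ ≤ ⟪c, x⟫_ℝ}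

/-- A belt polytope: a polytope whose normal fan is the fan induced by a central
hyperplane arrangement (two functionals maximize the same face iff they have the
same sign pattern with respect to the arrangement). -/
def IsBeltPolytope (P : Set (Euc d)) : Prop :=
  IsPolytope P ∧ ∃ (k : ℕ) (z : Fin k → Euc d), (∀ i, z i ≠ 0) ∧
    ∀ c c' : Euc d,
      ((∀ i, Real.sign ⟪z i, c⟫_ℝ = Real.sign ⟪z i, c'⟫_ℝ) ↔ maxFace P c = maxFace P c')

/-- The set of flats of a polytope: linear subspaces parallel to nonempty faces,
ordered by inclusion (as a subtype of `Submodule ℝ (Euc d)`). -/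
def Flats (P : Set (Euc d)) : Set (Submodule ℝ (Euc d)) :=
  {L | ∃ F : Set (Euc d), IsFace P F ∧ F.Nonempty ∧ L = vectorSpan ℝ F}

/-- Strictly increasing chains from `a` to `c` in a poset, encoded as lists. -/
def chainsFromTo {β : Type*} [Preorder β] (a c : β) : Set (List β) :=
  {l | l.Chain' (· < ·) ∧ l.head? = some a ∧ l.getLast? = some c}

/-- The Möbius function of a poset, via Philip Hall's chain formula. -/
def mob {β : Type*} [Preorder β] (a c : β) : ℝ :=
  ∑ᶠ l ∈ chainsFromTo a c, (-1 : ℝ) ^ (l.length + 1)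

/-- Whitney numbers of the first kind of a ranked poset with minimum `bot`. -/
def whitney1 {β : Type*} [Preorder β] (rk : β → ℕ) (bot : β) (i : ℕ) : ℝ :=
  ∑ᶠ a ∈ {a : β | rk a = i}, mob bot a

/-- Flag-Whitney numbers of the second kind: the number of chains with rank set `S`. -/
def flagW2 {β : Type*} [Preorder β] (rk : β → ℕ) (S : Finset ℕ) : ℕ :=
  Nat.card {l : List β // l.Chain' (· < ·) ∧ l.map rk = S.sort (· ≤ ·)}

/-- Flag-Whitney numbers of the first kind:
`w_S = Σ μ(0̂,c₁) μ(c₁,c₂) ⋯ μ(c_{k-1},c_k)` over chains with rank set `S`. -/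
def flagW1 {β : Type*} [Preorder β] (rk : β → ℕ) (bot : β) (S : Finset ℕ) : ℝ :=
  ∑ᶠ l ∈ {l : List β | l.Chain' (· < ·) ∧ l.map rk = S.sort (· ≤ ·)},
    (List.zipWith mob (bot :: l) l).prod

/-- Chains of nonempty faces of `P` whose dimensions are exactly the set `S`. -/
def faceChains (P : Set (Euc d)) (S : Finset ℕ) : Set (List (Set (Euc d))) :=
  {l | (∀ F ∈ l, IsFace P F ∧ F.Nonempty) ∧ l.Chain' (· ⊂ ·) ∧ l.map sdim = S.sort (· ≤ ·)}

/-- The interior flag-angle `α̂_S(P) = Σ α̂(F₁,F₂) α̂(F₂,F₃) ⋯ α̂(F_k,P)`. -/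
def intFlag (α : ConeAngle d) (P : Set (Euc d)) (S : Finset ℕ) : ℝ :=
  ∑ᶠ l ∈ faceChains P S, (List.zipWith (intAngle α) l (l.drop 1 ++ [P])).prod

/-- The exterior flag-angle `α̌_S(P) = Σ α̌(F₁,F₂) α̌(F₂,F₃) ⋯ α̌(F_k,P)`. -/
def extFlag (α : ConeAngle d) (P : Set (Euc d)) (S : Finset ℕ) : ℝ :=
  ∑ᶠ l ∈ faceChains P S, (List.zipWith (extAngle α) l (l.drop 1 ++ [P])).prod

/-- Membership in the incidence algebra: vanishing off the order relation. -/
def memIA {β : Type*} [Preorder β] (h : β → β → ℝ) : Prop :=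
  ∀ a c, ¬ a ≤ c → h a c = 0

/-- Convolution product of the incidence algebra. -/
def conv {β : Type*} [Preorder β] (g h : β → β → ℝ) (a c : β) : ℝ :=
  ∑ᶠ (b : β) (_ : a ≤ b ∧ b ≤ c), g a b * h b c

/-- The product `∗_k`, summing over middle elements of rank `k`. -/
def convk {β : Type*} (rk : β → ℕ) (k : ℕ) (g h : β → β → ℝ) (a c : β) : ℝ :=
  ∑ᶠ (b : β) (_ : rk b = k), g a b * h b c

/-- The pushforward `φ_* h (q,q') = |φ⁻¹(q')|⁻¹ Σ_{p ∈ φ⁻¹(q), p' ∈ φ⁻¹(q')} h(p,p')`. -/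
def pushf {β γ : Type*} (φ : β → γ) (h : β → β → ℝ) (q q' : γ) : ℝ :=
  (Nat.card {p : β // φ p = q'} : ℝ)⁻¹ *
    ∑ᶠ (p : β) (_ : φ p = q) (p' : β) (_ : φ p' = q'), h p p'

/-- The subspace `I_φ(𝒫)`: elements whose fiberwise column sums are independent of
the representative of the target fiber. -/
def memIphi {β γ : Type*} [Preorder β] (φ : β → γ) (h : β → β → ℝ) : Prop :=
  memIA h ∧ ∀ (q : γ) (p₁ p₂ : β), φ p₁ = φ p₂ →
    (∑ᶠ (p : β) (_ : φ p = q), h p p₁) = (∑ᶠ (p : β) (_ : φ p = q), h p p₂)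

open Classical in
/-- The pullback `φ^* g (p,p') = g(φ p, φ p')` for `p ≤ p'`, else `0`. -/
def pullb {β γ : Type*} [Preorder β] (φ : β → γ) (g : γ → γ → ℝ) (p p' : β) : ℝ :=
  if p ≤ p' then g (φ p) (φ p') else 0

open Classical in
/-- The identity `δ` of the incidence algebra. -/
def deltaIA {β : Type*} (a c : β) : ℝ := if a = c then 1 else 0

end GramAngles

namespace GramAngles

section Aux

open Classical

lemma pc_of {ι : Type*} [Fintype ι] (v : ι → Euc d) :
    IsPolyhedralCone {x | ∃ c : ι → ℝ, (∀ i, 0 ≤ c i) ∧ x = ∑ i, c i • v i} := by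
  let e := Fintype.equivFin ι
  refine ⟨Fintype.card ι, v ∘ e.symm, ?_⟩
  ext x
  constructor
  · rintro ⟨c, hc, rfl⟩
    refine ⟨c ∘ e.symm, fun i => hc _, ?_⟩
    exact (Equiv.sum_comp e.symm (fun i => c i • v i)).symm
  · rintro ⟨c, hc, rfl⟩
    refine ⟨c ∘ e, fun i => hc _, ?_⟩
    rw [← Equiv.sum_comp e.symm]
    simp

lemma pc_univ : IsPolyhedralCone (Set.univ : Set (Euc d)) := by
  have h := pc_of (d := d) (fun i : Fin d ⊕ Fin d =>
    Sum.elim (fun i => EuclideanSpace.single i (1:ℝ)) (fun i => -EuclideanSpace.single i (1:ℝ)) i)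
  convert h
  symm
  rw [Set.eq_univ_iff_forall]
  intro x
  refine ⟨Sum.elim (fun i => (x i)⁺) (fun i => (x i)⁻), ?_, ?_⟩
  · rintro (i | i)
    · exact posPart_nonneg _
    · exact negPart_nonneg _
  · rw [Fintype.sum_sum_type]
    ext j
    simp [Finset.sum_apply, Pi.single_apply]
    have := posPart_sub_negPart (x j)
    linarith

lemma pc_cut {K : Set (Euc d)} (hK : IsPolyhedralCone K) (u : Euc d) :
    IsPolyhedralCone (K ∩ {x | 0 ≤ ⟪u, x⟫_ℝ}) := by
  obtain ⟨n, v, rfl⟩ := hK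
  set a : Fin n → ℝ := fun i => ⟪u, v i⟫_ℝ with ha
  set n1 : Fin n → ℝ := fun i => if a i < 0 then 1 else 0 with hn1
  set p1 : Fin n → ℝ := fun i => if 0 < a i then 1 else 0 with hp1
  have hn0 : ∀ i, 0 ≤ n1 i := fun i => by simp only [hn1]; split_ifs <;> norm_num
  have hp0 : ∀ i, 0 ≤ p1 i := fun i => by simp only [hp1]; split_ifs <;> norm_num
  have hpp : ∀ i, 0 ≤ p1 i * a i := fun i => by simp only [hp1]; split_ifs <;> simp; linarith
  have hnn : ∀ i, 0 ≤ - (n1 i * a i) := fun i => by simp only [hn1]; split_ifs <;> simp; linarith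
  have hna : ∀ i, 0 ≤ (1 - n1 i) * a i := fun i => by simp only [hn1]; split_ifs <;> simp; linarith
  have hn1' : ∀ i, 0 ≤ 1 - n1 i := fun i => by simp only [hn1]; split_ifs <;> norm_num
  have hpn : ∀ i, p1 i * (1 - n1 i) = p1 i := fun i => by
    simp only [hn1, hp1]; split_ifs <;> simp; linarith
  have hadd : ∀ i, a i = p1 i * a i + n1 i * a i := fun i => by
    simp only [hn1, hp1]; split_ifs <;> simp <;> linarith
  have h := pc_of (d := d) (Sum.elim (fun i : Fin n => (1 - n1 i) • v i)
    (fun ij : Fin n × Fin n => (p1 ij.1 * a ij.1 * n1 ij.2) • v ij.2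
      + (- (n1 ij.2 * a ij.2) * p1 ij.1) • v ij.1))
  convert h using 1
  ext x
  constructor
  · rintro ⟨⟨c, hc, rfl⟩, hx⟩
    have hx' : 0 ≤ ∑ i, c i * a i := by
      have h2 : (0:ℝ) ≤ ⟪u, ∑ i, c i • v i⟫_ℝ := hx
      simpa [inner_sum, inner_smul_right] using h2
    set T := ∑ i, c i * (p1 i * a i) with hT
    set M := ∑ i, c i * (-(n1 i * a i)) with hM
    have hT0 : 0 ≤ T := Finset.sum_nonneg fun i _ => mul_nonneg (hc i) (hpp i)
    have hM0 : 0 ≤ M := Finset.sum_nonneg fun i _ => mul_nonneg (hc i) (hnn i)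
    have hTM : M ≤ T := by
      have : T - M = ∑ i, c i * a i := by
        rw [hT, hM, ← Finset.sum_sub_distrib]
        refine Finset.sum_congr rfl fun i _ => ?_
        linear_combination (- c i) * hadd i
      linarith
    rcases hT0.eq_or_lt with h0 | hpos
    · have hM00 : M = 0 := le_antisymm (h0 ▸ hTM) hM0
      have hz := (Finset.sum_eq_zero_iff_of_nonneg
        (fun i _ => mul_nonneg (hc i) (hnn i))).1 hM00
      refine ⟨Sum.elim c 0, ?_, ?_⟩
      · rintro (i | i)
        · exact hc i
        · exact le_rfl
      · rw [Fintype.sum_sum_type]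
        simp only [Sum.elim_inl, Sum.elim_inr, Pi.zero_apply, zero_smul, Finset.sum_const_zero,
          add_zero]
        refine Finset.sum_congr rfl fun i _ => ?_
        by_cases hi : a i < 0
        · have := hz i (Finset.mem_univ _)
          simp [hn1, hi] at this
          rcases this with h | h
          · simp [h]
          · linarith
        · simp [hn1, hi]
    · refine ⟨Sum.elim (fun i => c i * (1 - p1 i * (M / T))) (fun ij => c ij.1 * c ij.2 / T),
        ?_, ?_⟩
      · rintro (i | i)
        · have h1 : M / T ≤ 1 := (div_le_one hpos).2 hTM
          refine mul_nonneg (hc i) ?_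
          simp only [hp1]; split_ifs <;> simp; linarith
        · exact div_nonneg (mul_nonneg (hc _) (hc _)) hpos.le
      · rw [Fintype.sum_sum_type]
        simp only [Sum.elim_inl, Sum.elim_inr]
        rw [Fintype.sum_prod_type]
        simp only [smul_add, Finset.sum_add_distrib]
        have e1 : ∑ i, ∑ j, (c i * c j / T) • (p1 i * a i * n1 j) • v j
            = ∑ j, (c j * n1 j) • v j := by
          rw [Finset.sum_comm]
          refine Finset.sum_congr rfl fun j _ => ?_
          simp only [smul_smul]
          rw [← Finset.sum_smul]
          congr 1
          calc ∑ i, c i * c j / T * (p1 i * a i * n1 j)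
              = ∑ i, (c i * (p1 i * a i)) * (c j * n1 j / T) :=
                Finset.sum_congr rfl fun i _ => by ring
            _ = c j * n1 j := by rw [← Finset.sum_mul, ← hT]; field_simp
        have e2 : ∑ i, ∑ j, (c i * c j / T) • (-(n1 j * a j) * p1 i) • v i
            = ∑ i, (c i * p1 i * (M / T)) • v i := by
          refine Finset.sum_congr rfl fun i _ => ?_
          simp only [smul_smul]
          rw [← Finset.sum_smul]
          congr 1
          calc ∑ j, c i * c j / T * (-(n1 j * a j) * p1 i)
              = ∑ j, (c j * (-(n1 j * a j))) * (c i * p1 i / T) :=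
                Finset.sum_congr rfl fun i _ => by ring
            _ = _ := by rw [← Finset.sum_mul, ← hM]; ring
        rw [e1, e2, ← Finset.sum_add_distrib, ← Finset.sum_add_distrib]
        refine Finset.sum_congr rfl fun i _ => ?_
        rw [smul_smul, ← add_smul, ← add_smul]
        congr 1
        linear_combination (c i * (M / T)) * hpn i
  · rintro ⟨c, hc, rfl⟩
    constructor
    · refine ⟨fun i => c (Sum.inl i) * (1 - n1 i)
        + ∑ k, c (Sum.inr (k, i)) * (p1 k * a k * n1 i)
        + ∑ k, c (Sum.inr (i, k)) * (- (n1 k * a k) * p1 i), ?_, ?_⟩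
      · intro i
        refine add_nonneg (add_nonneg (mul_nonneg (hc _) (hn1' i)) ?_) ?_
        · exact Finset.sum_nonneg fun k _ => mul_nonneg (hc _) (mul_nonneg (hpp k) (hn0 i))
        · exact Finset.sum_nonneg fun k _ => mul_nonneg (hc _) (mul_nonneg (hnn k) (hp0 i))
      · rw [Fintype.sum_sum_type]
        simp only [Sum.elim_inl, Sum.elim_inr]
        rw [Fintype.sum_prod_type]
        simp only [smul_add, Finset.sum_add_distrib, add_smul, Finset.sum_smul, smul_smul]
        rw [Finset.sum_comm (f := fun i j => (c (Sum.inr (i, j)) * (p1 i * a i * n1 j)) • v j)]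
        abel
    · show (0:ℝ) ≤ ⟪u, _⟫_ℝ
      rw [inner_sum]
      refine Finset.sum_nonneg fun i _ => ?_
      rw [inner_smul_right]
      refine mul_nonneg (hc i) ?_
      rcases i with i | ⟨i, j⟩
      · simp only [Sum.elim_inl, inner_smul_right]
        exact hna i
      · simp only [Sum.elim_inr, inner_smul_right, inner_add_right]
        show 0 ≤ p1 i * a i * n1 j * a j + -(n1 j * a j) * p1 i * a i
        apply le_of_eq; ring

lemma pc_cuts {ι : Type*} {K : Set (Euc d)} (hK : IsPolyhedralCone K) (s : Finset ι)
    (u : ι → Euc d) : IsPolyhedralCone (K ∩ {x | ∀ i ∈ s, 0 ≤ ⟪u i, x⟫_ℝ}) := by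
  induction s using Finset.induction_on with
  | empty => simpa using hK
  | insert a s ha ih =>
    convert pc_cut ih (u a) using 1
    ext x; simp; tauto

lemma sdim_lt {K : Set (Euc d)} {u : Euc d} (hu : u ≠ 0) (h : ∀ x ∈ K, ⟪u, x⟫_ℝ = 0) :
    sdim K < d := by
  have h1 : vectorSpan ℝ K ≤ (ℝ ∙ u)ᗮ := by
    rw [vectorSpan_def, Submodule.span_le]
    rintro _ ⟨x, hx, y, hy, rfl⟩
    rw [SetLike.mem_coe, Submodule.mem_orthogonal_singleton_iff_inner_right]
    simp [inner_sub_right, h x hx, h y hy]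
  have h2 : vectorSpan ℝ K ≠ ⊤ := by
    intro h3
    rw [h3] at h1
    have : u ∈ (ℝ ∙ u)ᗮ := h1 trivial
    rw [Submodule.mem_orthogonal_singleton_iff_inner_right] at this
    exact hu (inner_self_eq_zero.1 this)
  have := Submodule.finrank_lt h2
  simpa [sdim] using this

lemma cut_add (α : ConeAngle d) {K : Set (Euc d)} (hK : IsPolyhedralCone K) {u : Euc d}
    (hu : u ≠ 0) : α.toFun K = α.toFun (K ∩ {x | 0 ≤ ⟪u, x⟫_ℝ})
      + α.toFun (K ∩ {x | 0 ≤ ⟪-u, x⟫_ℝ}) := by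
  have hU : (K ∩ {x | 0 ≤ ⟪u, x⟫_ℝ}) ∪ (K ∩ {x | 0 ≤ ⟪-u, x⟫_ℝ}) = K := by
    ext x; have := le_total 0 ⟪u, x⟫_ℝ; simp; tauto
  have hI : (K ∩ {x | 0 ≤ ⟪u, x⟫_ℝ}) ∩ (K ∩ {x | 0 ≤ ⟪-u, x⟫_ℝ})
      = (K ∩ {x | 0 ≤ ⟪u, x⟫_ℝ}) ∩ {x | 0 ≤ ⟪-u, x⟫_ℝ} := by
    ext x; simp; tauto
  have hIp := pc_cut (pc_cut hK u) (-u)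
  have h := α.union' _ _ (pc_cut hK u) (pc_cut hK (-u)) (by rwa [hU]) (by rwa [hI])
  rw [hU, hI, α.simple' _ hIp] at h
  · linarith
  · refine sdim_lt hu ?_
    rintro x ⟨⟨_, h1⟩, h2⟩
    simp at h1 h2
    linarith

lemma strict_or {ι : Type*} (α : ConeAngle d) (s : Finset ι) (u : ι → Euc d)
    (hu : ∀ i ∈ s, u i ≠ 0) (h : α.toFun {x | ∀ i ∈ s, 0 ≤ ⟪u i, x⟫_ℝ} ≠ 0) :
    ∃ x, ∀ i ∈ s, 0 < ⟪u i, x⟫_ℝ := by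
  have h1 : ∀ i ∈ s, ∃ x, (∀ i ∈ s, 0 ≤ ⟪u i, x⟫_ℝ) ∧ 0 < ⟪u i, x⟫_ℝ := by
    intro i hi
    by_contra hc
    push Not at hc
    refine h (α.simple' _ ?_ (sdim_lt (hu i hi) fun x hx => le_antisymm (hc x hx) (hx i hi)))
    simpa using pc_cuts pc_univ s u
  choose! x hx1 hx2 using h1
  refine ⟨∑ i ∈ s, x i, fun i hi => ?_⟩
  rw [inner_sum]
  exact Finset.sum_pos' (fun j hj => hx1 j hj i hi) ⟨i, hi, hx2 i hi⟩

/-- Signed vectors. -/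
def sg {ι : Type*} (B : Finset ι) (u : ι → Euc d) (j : ι) : Euc d := if j ∈ B then u j else - u j

lemma sum_signs {ι : Type*} (α : ConeAngle d) (J : Finset ι) (u : ι → Euc d)
    (hu : ∀ i ∈ J, u i ≠ 0) : ∀ {K : Set (Euc d)}, IsPolyhedralCone K →
    ∑ B ∈ J.powerset, α.toFun (K ∩ {x | ∀ i ∈ J, 0 ≤ ⟪sg B u i, x⟫_ℝ}) = α.toFun K := by
  induction J using Finset.induction_on with
  | empty => intro K hK; simp
  | insert a J ha ih =>
    intro K hK
    have hu' : ∀ i ∈ J, u i ≠ 0 := fun i hi => hu i (Finset.mem_insert_of_mem hi)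
    rw [Finset.sum_powerset_insert ha, cut_add α hK (hu a (Finset.mem_insert_self _ _)),
      add_comm, ← ih hu' (pc_cut hK (u a)), ← ih hu' (pc_cut hK (-u a))]
    congr 1
    · refine Finset.sum_congr rfl fun B hB => ?_
      congr 1
      have hB' := Finset.mem_powerset.1 hB
      ext x
      have e : ∀ i ∈ J, sg (insert a B) u i = sg B u i := by
        intro i hi
        have : i ≠ a := fun h => ha (h ▸ hi)
        simp [sg, this]
      have e2 : sg (insert a B) u a = u a := by simp [sg]
      simp only [Set.mem_inter_iff, Set.mem_ofPred_eq, Finset.forall_mem_insert, e2]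
      rw [and_assoc]
      refine and_congr_right fun _ => and_congr_right fun _ => ?_
      exact forall₂_congr fun i hi => by rw [e i hi]
    · refine Finset.sum_congr rfl fun B hB => ?_
      congr 1
      have hB' := Finset.mem_powerset.1 hB
      ext x
      have e2 : sg B u a = -u a := by
        have : a ∉ B := fun h => ha (hB' h)
        simp [sg, this]
      simp only [Set.mem_inter_iff, Set.mem_ofPred_eq, Finset.forall_mem_insert, e2]
      tauto

lemma sum_vertices (α : ConeAngle d) {V : Finset (Euc d)} (hV : V.Nonempty) :
    ∀ {K : Set (Euc d)}, IsPolyhedralCone K →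
    ∑ v ∈ V, α.toFun (K ∩ {x | ∀ w ∈ V, 0 ≤ ⟪v - w, x⟫_ℝ}) = α.toFun K := by
  induction hV using Finset.Nonempty.cons_induction with
  | singleton a => intro K hK; simp
  | cons a V ha hV ih =>
    intro K hK
    rw [Finset.sum_cons]
    have hN := pc_cuts hK (Finset.cons a V ha) (fun w => a - w)
    rw [← ih hN, ← ih hK, ← Finset.sum_add_distrib]
    refine Finset.sum_congr rfl fun v hv => ?_
    have hva : v - a ≠ 0 := sub_ne_zero.2 fun h => ha (h ▸ hv)
    rw [cut_add α (pc_cuts hK V (fun w => v - w)) hva, add_comm]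
    congr 2
    · ext x
      simp only [Set.mem_inter_iff, Set.mem_ofPred_eq, Finset.forall_mem_cons]
      tauto
    · ext x
      simp only [Set.mem_inter_iff, Set.mem_ofPred_eq, Finset.forall_mem_cons]
      simp only [inner_sub_left, inner_neg_left]
      constructor
      · rintro ⟨⟨h1, h2, h3⟩, h4⟩
        exact ⟨⟨h1, h4⟩, by have := h3 v hv; linarith⟩
      · rintro ⟨⟨h1, h2⟩, h3⟩
        refine ⟨⟨h1, by linarith, fun w hw => ?_⟩, h2⟩
        have := h2 w hw
        linarith

lemma face_iff (P F : Set (Euc d)) :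
    (IsFace P F ∧ F.Nonempty) ↔ (F.Nonempty ∧ ∃ c, F = maxFace P c) := by
  constructor
  · rintro ⟨h, hn⟩
    obtain ⟨l, hl⟩ := h hn
    refine ⟨hn, (InnerProductSpace.toDual ℝ (Euc d)).symm l, ?_⟩
    rw [hl]
    simp [maxFace]
  · rintro ⟨hn, c, hc⟩
    refine ⟨fun _ => ⟨InnerProductSpace.toDual ℝ (Euc d) c, ?_⟩, hn⟩
    rw [hc]
    simp [maxFace]

lemma le_of_hull {s : Finset (Euc d)} {c : Euc d} {m : ℝ} (h : ∀ w ∈ s, ⟪c, w⟫_ℝ ≤ m)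
    {y : Euc d} (hy : y ∈ convexHull ℝ (s : Set (Euc d))) : ⟪c, y⟫_ℝ ≤ m := by
  have h1 : convexHull ℝ (s : Set (Euc d)) ⊆ {x | ⟪c, x⟫_ℝ ≤ m} :=
    convexHull_min (fun w hw => h w hw)
      (convex_halfSpace_le (f := fun x => ⟪c, x⟫_ℝ) (innerₛₗ ℝ c).isLinear m)
  exact h1 hy

lemma normalCone_hull (s : Finset (Euc d)) (v : Euc d) :
    outerCone {v} (convexHull ℝ (s : Set (Euc d))) = {x | ∀ w ∈ s, 0 ≤ ⟪v - w, x⟫_ℝ} := by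
  ext x
  simp only [outerCone, vectorSpan_singleton, Submodule.bot_coe, Set.add_singleton, add_zero,
    Set.image_id', normalCone, Set.mem_ofPred_eq, Set.mem_singleton_iff, forall_eq]
  constructor
  · intro h w hw
    have := h w (subset_convexHull ℝ _ hw)
    rw [inner_sub_left, real_inner_comm, real_inner_comm x w]
    linarith
  · intro h y hy
    refine le_of_hull (fun w hw => ?_) hy
    have := h w hw
    rw [inner_sub_left, real_inner_comm, real_inner_comm x w] at this
    linarith

lemma extAngleSum_zero (α : ConeAngle d) {P : Set (Euc d)} (hP : IsPolytope P) :
    extAngleSum α P 0 = 1 := by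
  obtain ⟨s, hs, rfl⟩ := hP
  set P := convexHull ℝ (s : Set (Euc d)) with hPdef
  have hset : {F : Set (Euc d) | IsFace P F ∧ F.Nonempty ∧ sdim F = 0}
      = (fun v => ({v} : Set (Euc d))) '' (s.filter (fun v => IsFace P {v}) : Finset (Euc d)) := by
    ext F
    constructor
    · rintro ⟨hF, hn, h0⟩
      obtain ⟨-, c, hc⟩ := (face_iff P F).1 ⟨hF, hn⟩
      obtain ⟨w, hw, hmax⟩ := s.exists_max_image (fun w => ⟪c, w⟫_ℝ) hs
      have hwF : w ∈ F := by
        rw [hc]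
        exact ⟨subset_convexHull ℝ _ hw, fun y hy => le_of_hull hmax hy⟩
      have hsub : F.Subsingleton := by
        have : vectorSpan ℝ F = ⊥ := Submodule.finrank_eq_zero.1 h0
        intro x hx y hy
        have h1 := vsub_mem_vectorSpan ℝ hx hy
        rw [this] at h1
        exact sub_eq_zero.1 ((Submodule.mem_bot ℝ).1 h1)
      have hFw : F = {w} := hsub.eq_singleton_of_mem hwF
      refine ⟨w, ?_, hFw.symm⟩
      simp only [Finset.coe_filter, Set.mem_ofPred_eq]
      exact ⟨hw, hFw ▸ hF⟩
    · rintro ⟨v, hv, rfl⟩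
      simp only [Finset.coe_filter, Set.mem_ofPred_eq] at hv
      exact ⟨hv.2, Set.singleton_nonempty v, by simp [sdim]⟩
  unfold extAngleSum
  rw [hset, finsum_mem_image (Set.singleton_injective.injOn), finsum_mem_coe_finset,
    Finset.sum_filter_of_ne, ← α.norm', ← sum_vertices α hs pc_univ]
  · refine Finset.sum_congr rfl fun v hv => ?_
    rw [extAngle, normalCone_hull, Set.univ_inter]
  · intro v hv hne
    rw [extAngle, normalCone_hull] at hne
    have he : {x : Euc d | ∀ w ∈ s, 0 ≤ ⟪v - w, x⟫_ℝ}
        = {x : Euc d | ∀ w ∈ s.erase v, 0 ≤ ⟪v - w, x⟫_ℝ} := by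
      ext x
      constructor
      · intro h w hw
        exact h w (Finset.mem_of_mem_erase hw)
      · intro h w hw
        by_cases hwv : w = v
        · simp [hwv]
        · exact h w (Finset.mem_erase.2 ⟨hwv, hw⟩)
    rw [he] at hne
    obtain ⟨c, hc⟩ := strict_or α (s.erase v) (fun w => v - w)
      (fun w hw => sub_ne_zero.2 (Finset.ne_of_mem_erase hw).symm) hne
    have hlt : ∀ w ∈ s, w ≠ v → ⟪c, w⟫_ℝ < ⟪c, v⟫_ℝ := by
      intro w hw hwv
      have := hc w (Finset.mem_erase.2 ⟨hwv, hw⟩)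
      rw [inner_sub_left, real_inner_comm, real_inner_comm c w] at this
      linarith
    have hle : ∀ w ∈ s, ⟪c, w⟫_ℝ ≤ ⟪c, v⟫_ℝ := by
      intro w hw
      by_cases hwv : w = v
      · rw [hwv]
      · exact (hlt w hw hwv).le
    refine ((face_iff P {v}).2 ⟨Set.singleton_nonempty v, c, ?_⟩).1
    ext x
    simp only [Set.mem_singleton_iff]
    constructor
    · rintro rfl
      exact ⟨subset_convexHull ℝ _ hv, fun y hy => le_of_hull hle hy⟩
    · rintro ⟨hx, hmax⟩
      obtain ⟨t, ht0, ht1, rfl⟩ := Finset.mem_convexHull'.1 hx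
      have h1 := hmax v (subset_convexHull ℝ _ hv)
      have h2 : ∑ y ∈ s, t y * (⟪c, v⟫_ℝ - ⟪c, y⟫_ℝ) ≤ 0 := by
        simp only [mul_sub, Finset.sum_sub_distrib, ← Finset.sum_mul, ht1]
        rw [inner_sum] at h1
        simp only [inner_smul_right] at h1
        linarith
      have hnn : ∀ y ∈ s, 0 ≤ t y * (⟪c, v⟫_ℝ - ⟪c, y⟫_ℝ) :=
        fun y hy => mul_nonneg (ht0 y hy) (sub_nonneg.2 (hle y hy))
      have h3 := (Finset.sum_eq_zero_iff_of_nonneg hnn).1 (le_antisymm h2 (Finset.sum_nonneg hnn))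
      have h4 : ∀ y ∈ s, t y • y = t y • v := by
        intro y hy
        by_cases hyv : y = v
        · rw [hyv]
        · rcases mul_eq_zero.1 (h3 y hy) with h | h
          · simp [h]
          · have := hlt y hy hyv
            linarith
      rw [Finset.sum_congr rfl h4, ← Finset.sum_smul, ht1, one_smul]

/-! Zonotopes. -/

/-- Candidate faces of the zonotope. -/
def fc {n : ℕ} (z : Fin n → Euc d) (A B : Finset (Fin n)) : Set (Euc d) :=
  {x | ∃ t : Fin n → ℝ, (∀ j, 0 ≤ t j ∧ t j ≤ 1) ∧ (∀ j ∈ B, t j = 1) ∧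
    (∀ j, j ∉ A → j ∉ B → t j = 0) ∧ x = ∑ j, t j • z j}

/-- Indices orthogonal to `c`. -/
def nul {n : ℕ} (z : Fin n → Euc d) (c : Euc d) : Finset (Fin n) :=
  Finset.univ.filter (fun j => ⟪c, z j⟫_ℝ = 0)

/-- Indices positive on `c`. -/
def pos {n : ℕ} (z : Fin n → Euc d) (c : Euc d) : Finset (Fin n) :=
  Finset.univ.filter (fun j => 0 < ⟪c, z j⟫_ℝ)

lemma disj_nul_pos {n : ℕ} (z : Fin n → Euc d) (c : Euc d) : Disjoint (nul z c) (pos z c) := by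
  rw [Finset.disjoint_left]
  intro j h1 h2
  simp [nul, pos] at h1 h2
  linarith

lemma mem_Z {n : ℕ} (z : Fin n → Euc d) (x : Euc d) : x ∈ parallelepiped z ↔
    ∃ t : Fin n → ℝ, (∀ j, 0 ≤ t j ∧ t j ≤ 1) ∧ x = ∑ j, t j • z j := by
  rw [mem_parallelepiped_iff]
  simp [Pi.le_def, forall_and]

lemma fc_subset {n : ℕ} (z : Fin n → Euc d) (A B : Finset (Fin n)) :
    fc z A B ⊆ parallelepiped z := by
  rintro x ⟨t, h1, -, -, rfl⟩
  exact (mem_Z z _).2 ⟨t, h1, rfl⟩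

lemma sum_mem_Z {n : ℕ} (z : Fin n → Euc d) (S : Finset (Fin n)) :
    ∑ j ∈ S, z j ∈ parallelepiped z := by
  refine (mem_Z z _).2 ⟨fun j => if j ∈ S then 1 else 0, fun j => ?_, ?_⟩
  · dsimp only; split_ifs <;> norm_num
  · simp [Finset.sum_ite_mem]

lemma sum_mem_fc {n : ℕ} (z : Fin n → Euc d) {A B S : Finset (Fin n)} (h1 : B ⊆ S)
    (h2 : S ⊆ A ∪ B) : ∑ j ∈ S, z j ∈ fc z A B := by
  refine ⟨fun j => if j ∈ S then 1 else 0, fun j => ?_, ?_, ?_, ?_⟩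
  · dsimp only; split_ifs <;> norm_num
  · intro j hj; simp [h1 hj]
  · intro j hA hB
    have : j ∉ S := fun h => by
      rcases Finset.mem_union.1 (h2 h) with h | h
      · exact hA h
      · exact hB h
    simp [this]
  · simp [Finset.sum_ite_mem]

lemma fc_nonempty {n : ℕ} (z : Fin n → Euc d) (A B : Finset (Fin n)) : (fc z A B).Nonempty :=
  ⟨_, sum_mem_fc z (S := B) subset_rfl Finset.subset_union_right⟩

lemma inner_Z {n : ℕ} (z : Fin n → Euc d) (c : Euc d) (t : Fin n → ℝ) :
    ⟪c, ∑ j, t j • z j⟫_ℝ = ∑ j, t j * ⟪c, z j⟫_ℝ := by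
  rw [inner_sum]; simp [inner_smul_right]

lemma normalCone_fc {n : ℕ} (z : Fin n → Euc d) {A B : Finset (Fin n)} (hAB : Disjoint A B) :
    normalCone (fc z A B) (parallelepiped z) = {x | (∀ j ∈ A, ⟪x, z j⟫_ℝ = 0) ∧
      (∀ j ∈ B, 0 ≤ ⟪x, z j⟫_ℝ) ∧ ∀ j, j ∉ A → j ∉ B → ⟪x, z j⟫_ℝ ≤ 0} := by
  ext x
  constructor
  · intro h
    have hB := sum_mem_fc z (A := A) (S := B) subset_rfl Finset.subset_union_right
    refine ⟨fun j hj => ?_, fun j hj => ?_, fun j hA hB' => ?_⟩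
    · have hjB : j ∉ B := Finset.disjoint_left.1 hAB hj
      have h1 := sum_mem_fc z (A := A) (B := B) (S := insert j B) (Finset.subset_insert _ _)
        (Finset.insert_subset (Finset.mem_union_left _ hj) Finset.subset_union_right)
      have h2 := h _ hB _ (fc_subset z _ _ h1)
      have h3 := h _ h1 _ (fc_subset z _ _ hB)
      rw [Finset.sum_insert hjB, inner_add_right] at h2 h3
      linarith
    · have h2 := h _ hB _ (sum_mem_Z z (B.erase j))
      rw [← Finset.add_sum_erase B _ hj, inner_add_right] at h2
      linarith
    · have h2 := h _ hB _ (sum_mem_Z z (insert j B))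
      rw [Finset.sum_insert hB', inner_add_right] at h2
      linarith
  · rintro ⟨h1, h2, h3⟩ p ⟨t, ht, htB, ht0, rfl⟩ y hy
    obtain ⟨s, hs, rfl⟩ := (mem_Z z y).1 hy
    rw [inner_Z, inner_Z]
    refine Finset.sum_le_sum fun j _ => ?_
    by_cases hA : j ∈ A
    · simp [h1 j hA]
    · by_cases hB : j ∈ B
      · rw [htB j hB]
        exact mul_le_mul_of_nonneg_right (hs j).2 (h2 j hB)
      · rw [ht0 j hA hB]
        exact mul_le_mul_of_nonpos_right (hs j).1 (h3 j hA hB)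

lemma maxFace_eq {n : ℕ} (z : Fin n → Euc d) (c : Euc d) :
    maxFace (parallelepiped z) c = fc z (nul z c) (pos z c) := by
  have hc : c ∈ normalCone (fc z (nul z c) (pos z c)) (parallelepiped z) := by
    rw [normalCone_fc z (disj_nul_pos z c)]
    refine ⟨fun j hj => by simpa [nul] using hj, fun j hj => ?_, fun j _ hj => ?_⟩
    · have : 0 < ⟪c, z j⟫_ℝ := by simpa [pos] using hj
      exact this.le
    · simpa [pos] using hj
  ext x
  constructor
  · rintro ⟨hx, hmax⟩
    obtain ⟨t, ht, rfl⟩ := (mem_Z z x).1 hx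
    have h1 := hmax _ (sum_mem_Z z (pos z c))
    have hS : ∑ j ∈ pos z c, z j = ∑ j, (if j ∈ pos z c then (1:ℝ) else 0) • z j := by
      simp [Finset.sum_ite_mem]
    rw [hS, inner_Z, inner_Z] at h1
    have hnn : ∀ j ∈ (Finset.univ : Finset (Fin n)),
        0 ≤ ((if j ∈ pos z c then (1:ℝ) else 0) - t j) * ⟪c, z j⟫_ℝ := by
      intro j _
      split_ifs with h
      · have : 0 < ⟪c, z j⟫_ℝ := by simpa [pos] using h
        exact mul_nonneg (sub_nonneg.2 (ht j).2) this.le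
      · have : ⟪c, z j⟫_ℝ ≤ 0 := by simpa [pos] using h
        exact mul_nonneg_of_nonpos_of_nonpos (by linarith [(ht j).1]) this
    have h2 : ∑ j, ((if j ∈ pos z c then (1:ℝ) else 0) - t j) * ⟪c, z j⟫_ℝ = 0 := by
      refine le_antisymm ?_ (Finset.sum_nonneg hnn)
      simp only [sub_mul, Finset.sum_sub_distrib]
      linarith
    have h3 := (Finset.sum_eq_zero_iff_of_nonneg hnn).1 h2
    refine ⟨t, ht, fun j hj => ?_, fun j h0 hj => ?_, rfl⟩
    · have h4 := h3 j (Finset.mem_univ _)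
      have : 0 < ⟪c, z j⟫_ℝ := by simpa [pos] using hj
      rw [if_pos hj] at h4
      rcases mul_eq_zero.1 h4 with h | h <;> linarith
    · have h4 := h3 j (Finset.mem_univ _)
      have : ¬ ⟪c, z j⟫_ℝ = 0 := by simpa [nul] using h0
      rw [if_neg hj] at h4
      rcases mul_eq_zero.1 h4 with h | h
      · linarith
      · exact absurd h this
  · intro hx
    exact ⟨fc_subset z _ _ hx, fun y hy => hc x hx y hy⟩

lemma vectorSpan_fc {n : ℕ} (z : Fin n → Euc d) {A B : Finset (Fin n)} (hAB : Disjoint A B) :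
    vectorSpan ℝ (fc z A B) = Submodule.span ℝ (z '' A) := by
  apply le_antisymm
  · rw [vectorSpan_def, Submodule.span_le]
    rintro _ ⟨x, ⟨t, ht, htB, ht0, rfl⟩, y, ⟨s, hs, hsB, hs0, rfl⟩, rfl⟩
    show (∑ j, t j • z j) - (∑ j, s j • z j) ∈ Submodule.span ℝ (z '' (A : Set (Fin n)))
    rw [← Finset.sum_sub_distrib]
    refine Submodule.sum_mem _ fun j _ => ?_
    rw [← sub_smul]
    by_cases hA : j ∈ A
    · exact Submodule.smul_mem _ _ (Submodule.subset_span ⟨j, hA, rfl⟩)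
    · by_cases hB : j ∈ B
      · simp [htB j hB, hsB j hB]
      · simp [ht0 j hA hB, hs0 j hA hB]
  · rw [Submodule.span_le]
    rintro _ ⟨j, hj, rfl⟩
    have hj' : j ∈ A := hj
    have hjB : j ∉ B := Finset.disjoint_left.1 hAB hj'
    have hB := sum_mem_fc z (A := A) (S := B) subset_rfl Finset.subset_union_right
    have h1 := sum_mem_fc z (A := A) (B := B) (S := insert j B) (Finset.subset_insert _ _)
      (Finset.insert_subset (Finset.mem_union_left _ hj') Finset.subset_union_right)
    have h2 := vsub_mem_vectorSpan ℝ h1 hB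
    rw [Finset.sum_insert hjB, vsub_eq_sub, add_sub_cancel_right] at h2
    exact h2

/-- General position. -/
def GP {n : ℕ} (z : Fin n → Euc d) : Prop :=
  ∀ A : Finset (Fin n), A.card ≤ d → LinearIndepOn ℝ z (A : Set (Fin n))

lemma finrank_span {n : ℕ} {z : Fin n → Euc d} (hz : GP z) {A : Finset (Fin n)}
    (hA : A.card ≤ d) : Module.finrank ℝ (Submodule.span ℝ (z '' (A : Set (Fin n)))) = A.card := by
  have h := finrank_span_eq_card (hz A hA)
  have e : Set.range (fun x : (A : Set (Fin n)) => z x) = z '' (A : Set (Fin n)) := by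
    ext; simp
  rw [e] at h
  simpa using h

lemma le_finrank_span {n : ℕ} {z : Fin n → Euc d} (hz : GP z) {A : Finset (Fin n)}
    (hA : d ≤ A.card) : d ≤ Module.finrank ℝ (Submodule.span ℝ (z '' (A : Set (Fin n)))) := by
  obtain ⟨A', h1, h2⟩ := Finset.exists_subset_card_eq hA
  have h := finrank_span hz h2.le
  rw [h2] at h
  conv_lhs => rw [← h]
  exact Submodule.finrank_mono (Submodule.span_mono (Set.image_mono (by exact_mod_cast h1)))

/-- Projection of the generators. -/
def prj {n : ℕ} (z : Fin n → Euc d) (A : Finset (Fin n)) (j : Fin n) : Euc d :=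
  (Submodule.span ℝ (z '' (A : Set (Fin n))))ᗮ.starProjection (z j)

lemma prj_ne {n : ℕ} {z : Fin n → Euc d} (hz : GP z) {A : Finset (Fin n)}
    (hA : A.card < d) {j : Fin n} (hj : j ∉ A) : prj z A j ≠ 0 := by
  intro h
  have h1 := Submodule.sub_starProjection_mem_orthogonal
    (K := (Submodule.span ℝ (z '' (A : Set (Fin n))))ᗮ) (z j)
  unfold prj at h
  rw [h, sub_zero, Submodule.orthogonal_orthogonal] at h1
  have h2 := hz (insert j A) ((Finset.card_insert_le _ _).trans hA)
  rw [Finset.coe_insert, linearIndepOn_insert (by exact_mod_cast hj)] at h2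
  exact h2.2 h1

lemma inner_prj {n : ℕ} (z : Fin n → Euc d) (A : Finset (Fin n)) (j : Fin n) (x : Euc d) :
    ⟪prj z A j, x⟫_ℝ =
      ⟪(Submodule.span ℝ (z '' (A : Set (Fin n))))ᗮ.starProjection x, z j⟫_ℝ := by
  rw [prj, Submodule.inner_starProjection_left_eq_right, real_inner_comm]

lemma inner_proj_mem {n : ℕ} (z : Fin n → Euc d) {A : Finset (Fin n)} {j : Fin n} (hj : j ∈ A)
    (x : Euc d) :
    ⟪(Submodule.span ℝ (z '' (A : Set (Fin n))))ᗮ.starProjection x, z j⟫_ℝ = 0 := by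
  have h := Submodule.starProjection_apply_mem
    (Submodule.span ℝ (z '' (A : Set (Fin n))))ᗮ x
  rw [real_inner_comm]
  exact (Submodule.mem_orthogonal _ _).1 h _ (Submodule.subset_span ⟨j, hj, rfl⟩)

lemma outerCone_fc {n : ℕ} (z : Fin n → Euc d) {A B : Finset (Fin n)} (hAB : Disjoint A B) :
    outerCone (fc z A B) (parallelepiped z) =
      {x | ∀ j ∈ Aᶜ, 0 ≤ ⟪sg B (prj z A) j, x⟫_ℝ} := by
  set L := Submodule.span ℝ (z '' (A : Set (Fin n))) with hL
  rw [outerCone, vectorSpan_fc z hAB, normalCone_fc z hAB]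
  ext x
  constructor
  · rintro ⟨c, ⟨h0, hp, hn⟩, l, hl, rfl⟩ j hj
    have hcL : c ∈ Lᗮ := by
      rw [Submodule.mem_orthogonal]
      intro y hy
      induction hy using Submodule.span_induction with
      | mem y hy =>
        obtain ⟨k, hk, rfl⟩ := hy
        rw [real_inner_comm]; exact h0 k hk
      | zero => simp
      | add y y' _ _ h h' => rw [inner_add_left, h, h', add_zero]
      | smul a y _ h => rw [inner_smul_left, h, mul_zero]
    have hlL : Lᗮ.starProjection l = 0 := by
      rw [Submodule.starProjection_apply_eq_zero_iff, Submodule.orthogonal_orthogonal]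
      exact hl
    have e : ⟪prj z A j, c + l⟫_ℝ = ⟪c, z j⟫_ℝ := by
      rw [inner_prj, map_add, hlL, Submodule.starProjection_eq_self_iff.2 hcL, add_zero]
    have hj' : j ∉ A := by simpa using hj
    unfold sg
    split_ifs with hB
    · rw [e]; exact hp j hB
    · rw [inner_neg_left, e]
      have := hn j hj' hB
      linarith
  · intro h
    refine ⟨Lᗮ.starProjection x, ⟨fun j hj => inner_proj_mem z hj x, fun j hj => ?_,
      fun j hA hB => ?_⟩, x - Lᗮ.starProjection x, ?_, by simp⟩
    · have hA : j ∉ A := Finset.disjoint_right.1 hAB hj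
      have := h j (by simpa using hA)
      rwa [sg, if_pos hj, inner_prj] at this
    · have := h j (by simpa using hA)
      rw [sg, if_neg hB, inner_neg_left, inner_prj] at this
      linarith
    · have h1 := Submodule.sub_starProjection_mem_orthogonal (K := Lᗮ) x
      rw [Submodule.orthogonal_orthogonal] at h1
      exact h1

lemma fc_inj {n : ℕ} (z : Fin n → Euc d) {c c' : Euc d}
    (h : fc z (nul z c) (pos z c) = fc z (nul z c') (pos z c')) :
    nul z c = nul z c' ∧ pos z c = pos z c' := by
  have key : ∀ c c' : Euc d, fc z (nul z c) (pos z c) = fc z (nul z c') (pos z c') →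
      nul z c ⊆ nul z c' ∧ ∀ j ∈ pos z c, 0 ≤ ⟪c', z j⟫_ℝ := by
    intro c c' h
    have hc : c' ∈ normalCone (fc z (nul z c) (pos z c)) (parallelepiped z) := by
      rw [h, ← maxFace_eq]
      intro x hx y hy
      exact hx.2 y hy
    rw [normalCone_fc z (disj_nul_pos z c)] at hc
    exact ⟨fun j hj => by simpa [nul] using hc.1 j hj, hc.2.1⟩
  obtain ⟨h1, h2⟩ := key c c' h
  obtain ⟨h3, h4⟩ := key c' c h.symm
  have h5 := Finset.Subset.antisymm h1 h3
  refine ⟨h5, ?_⟩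
  ext j
  constructor
  · intro hj
    have hn : j ∉ nul z c' := h5 ▸ Finset.disjoint_right.1 (disj_nul_pos z c) hj
    have : ¬ ⟪c', z j⟫_ℝ = 0 := by simpa [nul] using hn
    simpa [pos] using lt_of_le_of_ne (h2 j hj) (Ne.symm this)
  · intro hj
    have hn : j ∉ nul z c := h5 ▸ Finset.disjoint_right.1 (disj_nul_pos z c') hj
    have : ¬ ⟪c, z j⟫_ℝ = 0 := by simpa [nul] using hn
    simpa [pos] using lt_of_le_of_ne (h4 j hj) (Ne.symm this)

lemma extAngleSum_Z (α : ConeAngle d) {n : ℕ} {z : Fin n → Euc d} (hz : GP z) {i : ℕ}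
    (hi : i < d) : extAngleSum α (parallelepiped z) i = n.choose i := by
  set T0 : Finset ((_ : Finset (Fin n)) × Finset (Fin n)) :=
    (Finset.powersetCard i Finset.univ).sigma (fun A => Aᶜ.powerset) with hT0
  have hmem : ∀ p, p ∈ T0 ↔ p.1.card = i ∧ Disjoint p.1 p.2 := by
    intro p
    simp only [hT0, Finset.mem_sigma, Finset.mem_powersetCard_univ, Finset.mem_powerset]
    rw [Finset.subset_compl_iff_disjoint_left]
  have hset : {F : Set (Euc d) | IsFace (parallelepiped z) F ∧ F.Nonempty ∧ sdim F = i}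
      = (fun p : (_ : Finset (Fin n)) × Finset (Fin n) => fc z p.1 p.2) ''
        (T0.filter (fun p => ∃ c, nul z c = p.1 ∧ pos z c = p.2) : Finset _) := by
    ext F
    constructor
    · rintro ⟨hF, hn, hd⟩
      obtain ⟨-, c, hc⟩ := (face_iff _ F).1 ⟨hF, hn⟩
      rw [maxFace_eq] at hc
      refine ⟨⟨nul z c, pos z c⟩, ?_, hc.symm⟩
      rw [Finset.mem_coe, Finset.mem_filter, hmem]
      refine ⟨⟨?_, disj_nul_pos z c⟩, c, rfl, rfl⟩
      rw [hc, sdim, vectorSpan_fc z (disj_nul_pos z c)] at hd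
      rcases le_total d (nul z c).card with h | h
      · have := le_finrank_span hz h
        omega
      · rw [finrank_span hz h] at hd
        exact hd
    · rintro ⟨⟨A, B⟩, hp, rfl⟩
      rw [Finset.mem_coe, Finset.mem_filter, hmem] at hp
      obtain ⟨⟨hA, hAB⟩, c, h1, h2⟩ := hp
      simp only at hA hAB h1 h2 ⊢
      have h3 := (face_iff (parallelepiped z) (fc z A B)).2
        ⟨fc_nonempty z A B, c, by rw [maxFace_eq, h1, h2]⟩
      refine ⟨h3.1, h3.2, ?_⟩
      rw [sdim, vectorSpan_fc z hAB, finrank_span hz (by omega), hA]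
  unfold extAngleSum
  rw [hset, finsum_mem_image, finsum_mem_coe_finset, Finset.sum_filter_of_ne, hT0,
    Finset.sum_sigma]
  · have : ∀ A ∈ Finset.powersetCard i (Finset.univ : Finset (Fin n)),
        ∑ B ∈ Aᶜ.powerset, extAngle α (fc z A B) (parallelepiped z) = 1 := by
      intro A hA
      rw [Finset.mem_powersetCard_univ] at hA
      rw [← α.norm', ← sum_signs α Aᶜ (prj z A)
        (fun j hj => prj_ne hz (by omega) (by simpa using hj)) pc_univ]
      refine Finset.sum_congr rfl fun B hB => ?_
      rw [Finset.mem_powerset, Finset.subset_compl_iff_disjoint_left] at hB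
      rw [extAngle, outerCone_fc z hB, Set.univ_inter]
    rw [Finset.sum_congr rfl this]
    simp
  · rintro ⟨A, B⟩ hp hne
    rw [hmem] at hp
    obtain ⟨hA, hAB⟩ := hp
    simp only at hA hAB hne ⊢
    rw [extAngle, outerCone_fc z hAB] at hne
    obtain ⟨x, hx⟩ := strict_or α Aᶜ (sg B (prj z A)) (fun j hj => by
      have := prj_ne hz (by omega) (A := A) (j := j) (by simpa using hj)
      unfold sg
      split_ifs
      · exact this
      · exact neg_ne_zero.2 this) hne
    set c := (Submodule.span ℝ (z '' (A : Set (Fin n))))ᗮ.starProjection x with hc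
    have hA0 : ∀ j ∈ A, ⟪c, z j⟫_ℝ = 0 := fun j hj => inner_proj_mem z hj x
    have hB0 : ∀ j ∈ B, 0 < ⟪c, z j⟫_ℝ := by
      intro j hj
      have hA : j ∉ A := Finset.disjoint_right.1 hAB hj
      have := hx j (by simpa using hA)
      rwa [sg, if_pos hj, inner_prj] at this
    have hN0 : ∀ j, j ∉ A → j ∉ B → ⟪c, z j⟫_ℝ < 0 := by
      intro j hA hB
      have := hx j (by simpa using hA)
      rw [sg, if_neg hB, inner_neg_left, inner_prj] at this
      linarith
    refine ⟨c, ?_, ?_⟩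
    · ext j
      simp only [nul, Finset.mem_filter, Finset.mem_univ, true_and]
      constructor
      · intro h
        by_contra hjA
        by_cases hjB : j ∈ B
        · exact (hB0 j hjB).ne' h
        · exact (hN0 j hjA hjB).ne h
      · exact hA0 j
    · ext j
      simp only [pos, Finset.mem_filter, Finset.mem_univ, true_and]
      constructor
      · intro h
        by_contra hjB
        by_cases hjA : j ∈ A
        · exact h.ne' (hA0 j hjA)
        · exact lt_asymm h (hN0 j hjA hjB)
      · exact hB0 j
  · rintro ⟨A, B⟩ hp ⟨A', B'⟩ hp' he
    rw [Finset.mem_coe, Finset.mem_filter] at hp hp'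
    obtain ⟨-, c, h1, h2⟩ := hp
    obtain ⟨-, c', h1', h2'⟩ := hp'
    simp only at h1 h2 h1' h2' he
    subst h1 h2 h1' h2'
    obtain ⟨e1, e2⟩ := fc_inj z he
    rw [e1, e2]

lemma polytope_Z {n : ℕ} (z : Fin n → Euc d) : IsPolytope (parallelepiped z) := by
  have hfin : (∑ i, ({(0 : Euc d), z i} : Set (Euc d))).Finite := by
    apply Set.Finite.subset ((Finset.univ : Finset (Finset (Fin n))).image
      (fun S => ∑ j ∈ S, z j)).finite_toSet
    intro x hx
    rw [Set.mem_finsetSum] at hx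
    obtain ⟨g, hg, rfl⟩ := hx
    simp only [Finset.coe_image, Finset.coe_univ, Set.image_univ, Set.mem_range]
    refine ⟨Finset.univ.filter (fun j => g j ≠ 0), ?_⟩
    rw [Finset.sum_filter]
    refine Finset.sum_congr rfl fun j _ => ?_
    have := hg (i := j) (Finset.mem_univ _)
    simp only [Set.mem_insert_iff, Set.mem_singleton_iff] at this
    by_cases h0 : g j = 0
    · simp [h0]
    · simp only [ne_eq, h0, not_false_eq_true, if_true]
      exact (this.resolve_left h0).symm
  refine ⟨hfin.toFinset, ?_, ?_⟩
  · rw [Set.Finite.toFinset_nonempty]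
    rw [← convexHull_nonempty_iff (𝕜 := ℝ), ← parallelepiped_eq_convexHull]
    exact ⟨_, sum_mem_Z z ∅⟩
  · rw [parallelepiped_eq_convexHull, Set.Finite.coe_toFinset]

lemma sdim_Z {n : ℕ} (hn : d ≤ n) {z : Fin n → Euc d} (hz : GP z) :
    sdim (parallelepiped z) = d := by
  have e : parallelepiped z = fc z Finset.univ ∅ := by
    ext x
    rw [mem_Z]
    simp [fc]
  apply le_antisymm
  · simpa [sdim] using Submodule.finrank_le (vectorSpan ℝ (parallelepiped z))
  · rw [sdim, e, vectorSpan_fc z (Finset.disjoint_empty_right _)]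
    exact le_finrank_span hz (by simpa using hn)

lemma exists_GP {n : ℕ} (hn : d ≤ n) : ∃ z : Fin n → Euc d, GP z := by
  refine ⟨fun j => WithLp.toLp 2 (fun k : Fin d => ((j : ℕ) : ℝ) ^ (k : ℕ)), fun A hA => ?_⟩
  obtain ⟨A', h1, h2⟩ := Finset.exists_superset_card_eq hA (by simpa using hn)
  refine LinearIndepOn.mono (s := (A' : Set (Fin n))) ?_ (by exact_mod_cast h1)
  let e : A' ≃ Fin d := A'.equivFinOfCardEq h2
  have hdet : (Matrix.vandermonde (fun i : Fin d => (((e.symm i : Fin n) : ℕ) : ℝ))).det ≠ 0 := by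
    rw [Matrix.det_vandermonde_ne_zero_iff]
    intro i j hij
    have h3 : ((e.symm i : Fin n) : ℕ) = ((e.symm j : Fin n) : ℕ) := Nat.cast_injective (R := ℝ) hij
    exact e.symm.injective (Subtype.ext (Fin.ext h3))
  have hli := Matrix.linearIndependent_rows_of_det_ne_zero hdet
  have hli2 := hli.map' ((WithLp.linearEquiv 2 ℝ (Fin d → ℝ)).symm : _ →ₗ[ℝ] Euc d)
    (LinearEquiv.ker _)
  have hli3 := hli2.comp e e.injective
  refine cast ?_ hli3
  congr 1
  funext x
  simp only [Matrix.vandermonde, Function.comp_apply]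
  apply (WithLp.linearEquiv 2 ℝ (Fin d → ℝ)).injective
  funext k
  simp

lemma choose_indep (N : ℕ) : ∀ (m : ℕ) (f : ℕ → ℝ),
    (∀ n, N ≤ n → ∑ i ∈ Finset.range m, f i * (n.choose i : ℝ) = 0) →
    ∀ i < m, f i = 0 := by
  intro m
  induction m with
  | zero => intro f _ i hi; omega
  | succ m ih =>
    intro f hf
    have h1 : ∀ i < m, f (i + 1) = 0 := by
      apply ih (fun i => f (i + 1))
      intro n hn
      have h2 := hf n hn
      have h3 := hf (n + 1) (by omega)
      rw [Finset.sum_range_succ'] at h2 h3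
      simp only [Nat.choose_succ_succ', Nat.cast_add, mul_add, Finset.sum_add_distrib,
        Nat.choose_zero_right] at h2 h3
      linarith
    intro i hi
    rcases i with _ | i
    · have h2 := hf N le_rfl
      rw [Finset.sum_range_succ', Finset.sum_eq_zero] at h2
      · simpa using h2
      · intro i hi
        rw [h1 i (Finset.mem_range.1 hi), zero_mul]
    · exact h1 i (by omega)

lemma span_choose (d : ℕ) :
    Submodule.span ℝ {v : Fin d → ℝ | ∃ n, d ≤ n ∧ v = fun i : Fin d => (n.choose i : ℝ)} = ⊤ := by
  by_contra h
  obtain ⟨f, hf0, hf⟩ := Submodule.exists_le_ker_of_lt_top _ (lt_top_iff_ne_top.2 h)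
  apply hf0
  have hcoef : ∀ v : Fin d → ℝ, f v = ∑ i, v i * f (Pi.single i 1) := by
    intro v
    conv_lhs => rw [pi_eq_sum_univ' v]
    simp [map_sum]
  set g : ℕ → ℝ := fun i => if hi : i < d then f (Pi.single ⟨i, hi⟩ 1) else 0 with hg
  have hz := choose_indep d d g (by
    intro n hn
    have h1 : f (fun i : Fin d => (n.choose i : ℝ)) = 0 :=
      hf (Submodule.subset_span ⟨n, hn, rfl⟩)
    rw [hcoef] at h1
    rw [Finset.sum_range, ← h1]
    refine Finset.sum_congr rfl fun i _ => ?_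
    simp [hg, mul_comm])
  ext i
  have := hz i i.2
  simpa [hg] using this

lemma affine_aux {d : ℕ} (hd : 0 < d) (S : Set (Fin d → ℝ)) (hS : ∀ v ∈ S, v ⟨0, hd⟩ = 1)
    (hne : S.Nonempty) (hspan : Submodule.span ℝ S = ⊤) :
    (affineSpan ℝ S : Set (Fin d → ℝ)) = {a | a ⟨0, hd⟩ = 1} := by
  obtain ⟨p, hp⟩ := hne
  have key : ∀ x : Fin d → ℝ, x - x ⟨0, hd⟩ • p ∈ vectorSpan ℝ S := by
    intro x
    have hx : x ∈ Submodule.span ℝ S := hspan ▸ Submodule.mem_top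
    induction hx using Submodule.span_induction with
    | mem x hx => rw [hS x hx, one_smul]; exact vsub_mem_vectorSpan ℝ hx hp
    | zero => simp
    | add x y _ _ h1 h2 =>
      have := Submodule.add_mem _ h1 h2
      convert this using 1
      simp only [Pi.add_apply, add_smul]
      abel
    | smul a x _ h =>
      have := Submodule.smul_mem _ a h
      convert this using 1
      simp only [Pi.smul_apply, smul_eq_mul, smul_sub, smul_smul]
  apply Set.Subset.antisymm
  · intro a ha
    refine affineSpan_induction (p := fun a => a ⟨0, hd⟩ = 1) ha hS ?_
    intro c u v w hu hv hw
    simp [hu, hv, hw]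
  · intro a ha
    have h1 := key a
    rw [show a ⟨0, hd⟩ = 1 from ha, one_smul] at h1
    have h2 := vadd_mem_affineSpan_of_mem_affineSpan_of_mem_vectorSpan
      (mem_affineSpan ℝ hp) h1
    simpa using h2

end Aux

/-- Corollary: affine hull of exterior angle vectors.
For `d ≥ 1` and a cone angle `α` on `ℝ^d`, the affine hull of the exterior angle
vectors of `d`-dimensional polytopes `P ⊂ ℝ^d` is `{a ∈ ℝ^d : a₀ = 1}`. -/
theorem statement6 (d : ℕ) (hd : 0 < d) (α : ConeAngle d) :
    (affineSpan ℝ {v : Fin d → ℝ | ∃ P : Set (Euc d), IsPolytope P ∧ sdim P = d ∧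
        v = fun i : Fin d => extAngleSum α P (i : ℕ)} : Set (Fin d → ℝ)) =
      {a : Fin d → ℝ | a ⟨0, hd⟩ = 1} := by
  refine affine_aux hd _ ?_ ?_ ?_
  · rintro v ⟨P, hP, -, rfl⟩
    exact extAngleSum_zero α hP
  · obtain ⟨z, hz⟩ := exists_GP (le_refl d)
    exact ⟨_, parallelepiped z, polytope_Z z, sdim_Z le_rfl hz, rfl⟩
  · rw [eq_top_iff, ← span_choose d]
    apply Submodule.span_mono
    rintro v ⟨n, hn, rfl⟩
    obtain ⟨z, hz⟩ := exists_GP hn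
    refine ⟨parallelepiped z, polytope_Z z, sdim_Z hn hz, ?_⟩
    funext i
    exact (extAngleSum_Z α hz i.2).symm

end GramAngles
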